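/- Let ω be continuously differentiable on [0,1] and let θ₀ < θ₁ < θ₂. If ℛ is strictly increasing on [θ₁, θ₂], then 𝒮(θ₁) < 𝒮(θ₂). Consequently, on any interval of θ on which ℛ is strictly increasing, the uniform-stream flow force 𝒮 is a strictly increasing function of the Bernoulli constant ℛ; in particular the supercritical flow force S₋(R) is strictly increasing in R there. -/

import Mathlib

/-- `Omg ω τ = ∫₀^τ ω(s) ds`. -/
noncomputable def Omg (ω : ℝ → ℝ) (τ : ℝ) : ℝ := ∫ s in (0:ℝ)..τ, ω s

/-- `theta0 ω = √(2 · max_{τ∈[0,1]} Ω(τ))`. -/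
noncomputable def theta0 (ω : ℝ → ℝ) : ℝ := Real.sqrt (2 * sSup (Omg ω '' Set.Icc 0 1))

/-- `Hfun ω θ p = ∫₀^p (θ² − 2Ω(τ))^{−1/2} dτ`. -/
noncomputable def Hfun (ω : ℝ → ℝ) (θ p : ℝ) : ℝ :=
  ∫ τ in (0:ℝ)..p, 1 / Real.sqrt (θ ^ 2 - 2 * Omg ω τ)

/-- `dfun ω θ = H(1;θ)`. -/
noncomputable def dfun (ω : ℝ → ℝ) (θ : ℝ) : ℝ := Hfun ω θ 1

/-- `Rcal ω θ = θ²/2 + d(θ) − Ω(1)`. -/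
noncomputable def Rcal (ω : ℝ → ℝ) (θ : ℝ) : ℝ := θ ^ 2 / 2 + dfun ω θ - Omg ω 1

/-- The uniform-stream flow force. -/
noncomputable def Scal (ω : ℝ → ℝ) (θ : ℝ) : ℝ :=
  ∫ p in (0:ℝ)..1,
    ((1/2) * Real.sqrt (θ ^ 2 - 2 * Omg ω p)
      + (Omg ω 1 - Omg ω p - Hfun ω θ p + Rcal ω θ) / Real.sqrt (θ ^ 2 - 2 * Omg ω p))

open Set Filter Topology MeasureTheory

/-- Differentiation under the integral sign for `θ ↦ ∫ f (θ² - g p) dp`. -/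
lemma hasDerivAt_integral_comp_sq_sub {f f' g : ℝ → ℝ} {θ : ℝ}
    (hf : ∀ x, 0 < x → HasDerivAt f (f' x) x) (hf' : ContinuousOn f' (Ioi 0))
    (hg : ContinuousOn g (Icc 0 1)) (hθ : ∃ m, 0 < m ∧ m < θ ∧ ∀ p ∈ Icc (0:ℝ) 1, g p < m ^ 2) :
    HasDerivAt (fun t => ∫ p in (0:ℝ)..1, f (t ^ 2 - g p))
      (∫ p in (0:ℝ)..1, f' (θ ^ 2 - g p) * (2 * θ)) θ := by
  obtain ⟨m, hm, hmθ, hgm⟩ := hθ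
  have hpos : ∀ t, m ≤ t → ∀ p ∈ Icc (0:ℝ) 1, 0 < t ^ 2 - g p := fun t ht p hp => by
    nlinarith [hgm p hp]
  have hsub : uIoc (0:ℝ) 1 ⊆ Icc 0 1 := by
    rw [uIoc_of_le zero_le_one]; exact Ioc_subset_Icc_self
  have hfc : ContinuousOn f (Ioi 0) := fun x hx => (hf x hx).continuousAt.continuousWithinAt
  have hcf : ∀ t, m ≤ t → ContinuousOn (fun p => f (t ^ 2 - g p)) (Icc 0 1) := fun t ht =>
    hfc.comp (continuousOn_const.sub hg) (fun p hp => hpos t ht p hp)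
  have hcf' : ContinuousOn (fun q : ℝ × ℝ => f' (q.1 ^ 2 - g q.2) * (2 * q.1))
      (Icc m (θ + 1) ×ˢ Icc 0 1) := by
    refine ContinuousOn.mul (hf'.comp (ContinuousOn.sub (by fun_prop)
      (hg.comp continuousOn_snd fun q hq => hq.2)) fun q hq => hpos q.1 hq.1.1 q.2 hq.2) ?_
    fun_prop
  obtain ⟨C, hC⟩ := (isCompact_Icc.prod isCompact_Icc).exists_bound_of_continuousOn hcf'
  have hnhds : Icc m (θ + 1) ∈ 𝓝 θ := Icc_mem_nhds hmθ (by linarith)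
  refine (intervalIntegral.hasDerivAt_integral_of_dominated_loc_of_deriv_le
    (F := fun t p => f (t ^ 2 - g p)) (F' := fun t p => f' (t ^ 2 - g p) * (2 * t))
    (bound := fun _ => C) hnhds ?_ ?_ ?_ ?_ ?_ ?_).2
  · filter_upwards [hnhds] with t ht
    exact ((hcf t ht.1).mono hsub).aestronglyMeasurable measurableSet_uIoc
  · exact ContinuousOn.intervalIntegrable_of_Icc zero_le_one (hcf θ hmθ.le)
  · refine ContinuousOn.aestronglyMeasurable ?_ measurableSet_uIoc
    exact hcf'.comp (f := fun p => (θ, p)) (by fun_prop)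
      fun p hp => ⟨⟨hmθ.le, by linarith⟩, hsub hp⟩
  · exact Eventually.of_forall fun p hp t ht => hC (t, p) ⟨ht, hsub hp⟩
  · exact intervalIntegrable_const
  · refine Eventually.of_forall fun p hp t ht => ?_
    have h := (hf _ (hpos t ht.1 p (hsub hp))).comp t (((hasDerivAt_id t).pow 2).sub_const (g p))
    simpa [Function.comp_def] using h

/-- For `v` continuous on `[0,1]` with primitive `V`, `∫₀¹ (V 1 - V) v = (V 1)² / 2`. -/
lemma integral_sub_primitive_mul {v : ℝ → ℝ} (hv : ContinuousOn v (Icc 0 1)) :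
    ∫ p in (0:ℝ)..1, ((∫ τ in (0:ℝ)..1, v τ) - ∫ τ in (0:ℝ)..p, v τ) * v p =
      (∫ τ in (0:ℝ)..1, v τ) ^ 2 / 2 := by
  have hint : IntervalIntegrable v volume 0 1 := hv.intervalIntegrable_of_Icc zero_le_one
  have hV : ContinuousOn (fun p => ∫ τ in (0:ℝ)..p, v τ) (Icc 0 1) := by
    have := intervalIntegral.continuousOn_primitive_interval' hint left_mem_uIcc
    rwa [uIcc_of_le zero_le_one] at this
  set d := ∫ τ in (0:ℝ)..1, v τ with hd
  rw [intervalIntegral.integral_eq_sub_of_hasDerivAt_of_le zero_le_one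
    (f := fun p => d * (∫ τ in (0:ℝ)..p, v τ) - (∫ τ in (0:ℝ)..p, v τ) ^ 2 / 2)]
  · simp only [intervalIntegral.integral_same, ← hd]
    ring
  · exact (continuousOn_const.mul hV).sub ((hV.pow 2).div_const 2)
  · intro p hp
    have hVp : HasDerivAt (fun p => ∫ τ in (0:ℝ)..p, v τ) (v p) p :=
      intervalIntegral.integral_hasDerivAt_right
        (hint.mono_set (by
          rw [uIcc_of_le hp.1.le, uIcc_of_le zero_le_one]; exact Icc_subset_Icc_right hp.2.le))
        (hv.mono Ioo_subset_Icc_self |>.stronglyMeasurableAtFilter isOpen_Ioo p hp)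
        (hv.continuousAt (Icc_mem_nhds hp.1 hp.2))
    refine ((hVp.const_mul d).sub ((hVp.pow 2).div_const 2)).congr_deriv ?_
    push_cast
    ring
  · exact ((continuousOn_const.sub hV).mul hv).intervalIntegrable_of_Icc zero_le_one

/-- If the derivative of `S` is `d` times that of `R`, `d > 0`, and `R` is strictly increasing, then so is `S`. -/
lemma strictMonoOn_of_hasDerivAt_mul {R S R' d : ℝ → ℝ} {a b : ℝ}
    (hR : ∀ t ∈ Icc a b, HasDerivAt R (R' t) t) (hS : ∀ t ∈ Icc a b, HasDerivAt S (d t * R' t) t)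
    (hd : ∀ t ∈ Icc a b, 0 < d t) (hmono : StrictMonoOn R (Icc a b)) :
    StrictMonoOn S (Icc a b) := by
  have hR0 : ∀ t ∈ Ioo a b, 0 ≤ R' t := fun t ht => by
    have h := hmono.monotoneOn.derivWithin_nonneg (x := t)
    rwa [derivWithin_of_mem_nhds (Icc_mem_nhds ht.1 ht.2),
      (hR t (Ioo_subset_Icc_self ht)).deriv] at h
  have hSm : MonotoneOn S (Icc a b) := by
    refine monotoneOn_of_deriv_nonneg (convex_Icc a b)
      (fun t ht => (hS t ht).continuousAt.continuousWithinAt)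
      (fun t ht => (hS t (interior_subset ht)).differentiableAt.differentiableWithinAt) ?_
    intro t ht
    rw [(hS t (interior_subset ht)).deriv]
    rw [interior_Icc] at ht
    exact mul_nonneg (hd t (Ioo_subset_Icc_self ht)).le (hR0 t ht)
  intro x hx y hy hxy
  have hsub : Icc x y ⊆ Icc a b := Icc_subset_Icc hx.1 hy.2
  refine (hSm hx hy hxy.le).lt_of_ne fun heq => ?_
  obtain ⟨c, hc, hcR⟩ := exists_hasDerivAt_eq_slope R R' hxy
    (fun t ht => (hR t (hsub ht)).continuousAt.continuousWithinAt)
    (fun t ht => hR t (hsub (Ioo_subset_Icc_self ht)))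
  have hc' := hsub (Ioo_subset_Icc_self hc)
  have hpos : 0 < R' c := by
    rw [hcR]; exact div_pos (sub_pos.2 (hmono hx hy hxy)) (sub_pos.2 hxy)
  have hconst : S =ᶠ[𝓝 c] fun _ => S x := by
    filter_upwards [Icc_mem_nhds hc.1 hc.2] with t ht
    exact le_antisymm (heq ▸ hSm (hsub ht) hy ht.2) (hSm hx (hsub ht) ht.1)
  have h0 := (hS c hc').unique ((hasDerivAt_const c (S x)).congr_of_eventuallyEq hconst)
  exact (mul_pos (hd c hc') hpos).ne' h0

lemma continuousOn_Omg {ω : ℝ → ℝ} (hω : ContinuousOn ω (Icc 0 1)) :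
    ContinuousOn (Omg ω) (Icc 0 1) := by
  have := intervalIntegral.continuousOn_primitive_interval'
    (hω.intervalIntegrable_of_Icc (μ := volume) zero_le_one) left_mem_uIcc
  rwa [uIcc_of_le zero_le_one] at this

lemma two_mul_Omg_le_theta0_sq {ω : ℝ → ℝ} (hω : ContinuousOn ω (Icc 0 1)) {p : ℝ}
    (hp : p ∈ Icc (0:ℝ) 1) : 2 * Omg ω p ≤ theta0 ω ^ 2 := by
  have hbdd : BddAbove (Omg ω '' Icc 0 1) :=
    isCompact_Icc.bddAbove_image (continuousOn_Omg hω)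
  have h0 : 0 ≤ sSup (Omg ω '' Icc 0 1) :=
    le_csSup hbdd ⟨0, ⟨le_rfl, zero_le_one⟩, by simp [Omg]⟩
  rw [theta0, Real.sq_sqrt (by linarith)]
  linarith [le_csSup hbdd (mem_image_of_mem _ hp)]

lemma sq_sub_two_mul_Omg_pos {ω : ℝ → ℝ} (hω : ContinuousOn ω (Icc 0 1)) {θ p : ℝ}
    (hθ : theta0 ω < θ) (hp : p ∈ Icc (0:ℝ) 1) : 0 < θ ^ 2 - 2 * Omg ω p := by
  have h0 : 0 ≤ theta0 ω := Real.sqrt_nonneg _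
  nlinarith [two_mul_Omg_le_theta0_sq hω hp]

lemma continuousOn_one_div_sqrt {ω : ℝ → ℝ} (hω : ContinuousOn ω (Icc 0 1)) {θ : ℝ}
    (hθ : theta0 ω < θ) :
    ContinuousOn (fun p => 1 / Real.sqrt (θ ^ 2 - 2 * Omg ω p)) (Icc 0 1) :=
  continuousOn_const.div
    (continuousOn_const.sub (continuousOn_const.mul (continuousOn_Omg hω))).sqrt
    fun _ hp => (Real.sqrt_pos.2 (sq_sub_two_mul_Omg_pos hω hθ hp)).ne'

lemma dfun_pos {ω : ℝ → ℝ} (hω : ContinuousOn ω (Icc 0 1)) {θ : ℝ} (hθ : theta0 ω < θ) :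
    0 < dfun ω θ :=
  intervalIntegral.intervalIntegral_pos_of_pos_on
    ((continuousOn_one_div_sqrt hω hθ).intervalIntegrable_of_Icc zero_le_one)
    (fun _ hp => one_div_pos.2 (Real.sqrt_pos.2
      (sq_sub_two_mul_Omg_pos hω hθ (Ioo_subset_Icc_self hp)))) zero_lt_one

/-- The flow force of a uniform stream is `∫₀¹ √(θ² - 2Ω) + d(θ)² / 2`. -/
lemma Scal_eq {ω : ℝ → ℝ} (hω : ContinuousOn ω (Icc 0 1)) {θ : ℝ} (hθ : theta0 ω < θ) :
    Scal ω θ = (∫ p in (0:ℝ)..1, Real.sqrt (θ ^ 2 - 2 * Omg ω p)) + dfun ω θ ^ 2 / 2 := by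
  have hv := continuousOn_one_div_sqrt hω hθ
  have hu : ContinuousOn (fun p => Real.sqrt (θ ^ 2 - 2 * Omg ω p)) (Icc 0 1) :=
    (continuousOn_const.sub (continuousOn_const.mul (continuousOn_Omg hω))).sqrt
  have hint : IntervalIntegrable (fun p => 1 / Real.sqrt (θ ^ 2 - 2 * Omg ω p)) volume 0 1 :=
    hv.intervalIntegrable_of_Icc zero_le_one
  have hV : ContinuousOn (Hfun ω θ) (Icc 0 1) := by
    have := intervalIntegral.continuousOn_primitive_interval' hint left_mem_uIcc
    rwa [uIcc_of_le zero_le_one] at this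
  have hsq : dfun ω θ ^ 2 / 2 = ∫ p in (0:ℝ)..1,
      (dfun ω θ - Hfun ω θ p) * (1 / Real.sqrt (θ ^ 2 - 2 * Omg ω p)) :=
    (integral_sub_primitive_mul hv).symm
  have hprod : ContinuousOn
      (fun p => (dfun ω θ - Hfun ω θ p) * (1 / Real.sqrt (θ ^ 2 - 2 * Omg ω p))) (Icc 0 1) :=
    (continuousOn_const.sub hV).mul hv
  rw [hsq, ← intervalIntegral.integral_add (hu.intervalIntegrable_of_Icc zero_le_one)
    (hprod.intervalIntegrable_of_Icc zero_le_one)]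
  refine intervalIntegral.integral_congr fun p hp => ?_
  rw [uIcc_of_le zero_le_one] at hp
  have hpos := sq_sub_two_mul_Omg_pos hω hθ hp
  have hne := (Real.sqrt_pos.2 hpos).ne'
  have hs := Real.sq_sqrt hpos.le
  simp only [Rcal]
  field_simp
  linear_combination -hs

/-- The derivative of the flow force is the depth times the derivative of the Bernoulli constant. -/
lemma exists_hasDerivAt_Rcal_Scal {ω : ℝ → ℝ} (hω : ContinuousOn ω (Icc 0 1)) {θ : ℝ}
    (hθ : theta0 ω < θ) :
    ∃ r, HasDerivAt (Rcal ω) r θ ∧ HasDerivAt (Scal ω) (dfun ω θ * r) θ := by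
  have h0 : 0 ≤ theta0 ω := Real.sqrt_nonneg _
  obtain ⟨m, hm0, hmθ⟩ := exists_between hθ
  have hm : ∃ m, 0 < m ∧ m < θ ∧ ∀ p ∈ Icc (0:ℝ) 1, 2 * Omg ω p < m ^ 2 :=
    ⟨m, h0.trans_lt hm0, hmθ, fun p hp => by linarith [sq_sub_two_mul_Omg_pos hω hm0 hp]⟩
  have hg : ContinuousOn (fun p => 2 * Omg ω p) (Icc 0 1) :=
    continuousOn_const.mul (continuousOn_Omg hω)
  have hsqrt : ContinuousOn (fun x => 1 / (2 * Real.sqrt x)) (Ioi 0) :=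
    continuousOn_const.div (by fun_prop) fun x hx => by
      have := Real.sqrt_pos.2 (mem_Ioi.1 hx); positivity
  have hU := hasDerivAt_integral_comp_sq_sub (f := Real.sqrt)
    (fun x hx => Real.hasDerivAt_sqrt hx.ne') hsqrt hg hm
  obtain ⟨d', hd⟩ : ∃ d', HasDerivAt (dfun ω) d' θ := ⟨_, hasDerivAt_integral_comp_sq_sub (f := fun x => 1 / Real.sqrt x)
    (f' := fun x => -(1 / (2 * Real.sqrt x)) / Real.sqrt x ^ 2)
    (fun x hx => by
      simpa only [one_div, Pi.inv_def] using
        (Real.hasDerivAt_sqrt hx.ne').inv (Real.sqrt_pos.2 hx).ne')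
    (hsqrt.neg.div (by fun_prop) fun x hx => by
      have := Real.sqrt_pos.2 (mem_Ioi.1 hx); positivity) hg hm⟩
  have hUd : ∫ p in (0:ℝ)..1, 1 / (2 * Real.sqrt (θ ^ 2 - 2 * Omg ω p)) * (2 * θ) =
      θ * dfun ω θ := by
    rw [dfun, Hfun, ← intervalIntegral.integral_const_mul]
    refine intervalIntegral.integral_congr fun p _ => ?_
    simp only [one_div, mul_inv]
    ring
  rw [hUd] at hU
  refine ⟨θ + d', ?_, ?_⟩
  · refine (((((hasDerivAt_id θ).pow 2).div_const 2).add hd).sub_const (Omg ω 1)).congr_deriv ?_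
    simp
  · have hS := (hU.add ((hd.pow 2).div_const 2)).congr_of_eventuallyEq (f₁ := Scal ω)
      (by filter_upwards [Ioi_mem_nhds hθ] with t ht using Scal_eq hω ht)
    refine hS.congr_deriv ?_
    push_cast
    ring

/-- if `θ₀ < θ₁ < θ₂` and `ℛ` is strictly increasing on `[θ₁, θ₂]`, then
`𝒮(θ₁) < 𝒮(θ₂)`; consequently on such an interval `𝒮` is a strictly increasing function of the
Bernoulli constant `ℛ` (the supercritical flow force `S₋(R)` is strictly increasing in `R`). -/
theorem stmt8 (ω : ℝ → ℝ) (hω : ContDiffOn ℝ 1 ω (Set.Icc 0 1))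
    (θ₁ θ₂ : ℝ) (h1 : theta0 ω < θ₁) (h2 : θ₁ < θ₂)
    (hmono : StrictMonoOn (Rcal ω) (Set.Icc θ₁ θ₂)) :
    Scal ω θ₁ < Scal ω θ₂ ∧
    ∀ a ∈ Set.Icc θ₁ θ₂, ∀ b ∈ Set.Icc θ₁ θ₂,
      Rcal ω a < Rcal ω b → Scal ω a < Scal ω b := by
  have hc := hω.continuousOn
  have hθ : ∀ t ∈ Set.Icc θ₁ θ₂, theta0 ω < t := fun t ht => h1.trans_le ht.1
  choose! r hR hS using fun (t : ℝ) (ht : theta0 ω < t) => exists_hasDerivAt_Rcal_Scal hc ht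
  have hSmono : StrictMonoOn (Scal ω) (Set.Icc θ₁ θ₂) :=
    strictMonoOn_of_hasDerivAt_mul (fun t ht => hR t (hθ t ht)) (fun t ht => hS t (hθ t ht))
      (fun t ht => dfun_pos hc (hθ t ht)) hmono
  exact ⟨hSmono (Set.left_mem_Icc.2 h2.le) (Set.right_mem_Icc.2 h2.le) h2,
    fun a ha b hb hab => hSmono ha hb ((hmono.lt_iff_lt ha hb).1 hab)⟩
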